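/- arXiv:0801.0283 — 2 statements merged into one kernel-verified Lean document; each statement's English description precedes it below -/
import Mathlib

section
/- The Cayley form cay on ℝ⁸ has comass exactly 1 and Euclidean norm squared exactly 14; in particular the Wirtinger ratio |cay|²/‖cay‖² equals 14. -/
noncomputable section

open scoped BigOperators
open Matrix

/-- `ℝ⁸` with its standard Euclidean structure. -/
abbrev E8 : Type := EuclideanSpace ℝ (Fin 8)

/-- The standard orthonormal basis `e₁, …, e₈` of `ℝ⁸`. -/
def stdB : Fin 8 → E8 := fun i => EuclideanSpace.single i 1

/-- The `j`-th coordinate functional `eʲ`. -/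
def coordL (j : Fin 8) : E8 →ₗ[ℝ] ℝ :=
  (LinearMap.proj j).comp (WithLp.linearEquiv 2 ℝ (Fin 8 → ℝ)).toLinearMap

/-- Alternating 4-forms on `ℝ⁸`. -/
abbrev Form4 : Type := AlternatingMap ℝ E8 ℝ (Fin 4)

/-- The decomposable 4-form `eᵃ∧eᵇ∧eᶜ∧eᵈ` (value `det` of the coordinates). -/
def wedge4 (a b c d : Fin 8) : Form4 :=
  (Matrix.detRowAlternating : AlternatingMap ℝ (Fin 4 → ℝ) ℝ (Fin 4)).compLinearMap
    (LinearMap.pi (fun i : Fin 4 => coordL (![a, b, c, d] i)))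

/-- The comass `‖ω‖` of a 4-form: the sup of values on unit vectors. -/
def comass (ω : Form4) : ℝ :=
  sSup {r : ℝ | ∃ v : Fin 4 → E8, (∀ i, ‖v i‖ = 1) ∧ ω v = r}

open scoped Classical in
/-- The square `|ω|²` of the Euclidean norm of a 4-form:
the sum of the squares of the coefficients over increasing multi-indices. -/
def eNormSq (ω : Form4) : ℝ :=
  ∑ f ∈ Finset.univ.filter (fun f : Fin 4 → Fin 8 => StrictMono f),
    (ω (fun i => stdB (f i))) ^ 2

/-- `e^{1234}` (1-indexed), i.e. `e¹∧e²∧e³∧e⁴` plus its Hodge dual. -/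
def E1234 : Form4 := wedge4 0 1 2 3 + wedge4 4 5 6 7
def E1256 : Form4 := wedge4 0 1 4 5 + wedge4 2 3 6 7
def E1278 : Form4 := wedge4 0 1 6 7 + wedge4 2 3 4 5
def E1357 : Form4 := wedge4 0 2 4 6 + wedge4 1 3 5 7
def E1467 : Form4 := wedge4 0 3 5 6 + wedge4 1 2 4 7
def E1368 : Form4 := wedge4 0 2 5 7 + wedge4 1 3 4 6
def E1458 : Form4 := wedge4 0 3 4 7 + wedge4 1 2 5 6

/-- The Cayley form. -/
def cay : Form4 := E1234 + E1256 + E1278 + E1357 - E1368 - E1458 - E1467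

/-- A 4-form on `ℝ⁸` is self-dual if `ω(e_f) = ω(e_g)` whenever `f`, `g` are complementary
increasing multi-indices whose concatenation is an even permutation of `(1,…,8)`
(i.e. induces the standard orientation). -/
def SelfDual (ω : Form4) : Prop :=
  ∀ (f g : Fin 4 → Fin 8) (σ : Equiv.Perm (Fin 8)),
    StrictMono f → StrictMono g →
    (∀ i : Fin 8, σ i = Fin.append f g (Fin.cast (by norm_num) i)) →
    Equiv.Perm.sign σ = 1 →
    ω (fun i => stdB (f i)) = ω (fun i => stdB (g i))

/-- Membership in `SO(8)`, as real `8 × 8` matrices. -/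
def IsSO8 (g : Matrix (Fin 8) (Fin 8) ℝ) : Prop := g * gᵀ = 1 ∧ g.det = 1

/-- The linear action of an `8 × 8` matrix on `ℝ⁸`. -/
def mulVecL (g : Matrix (Fin 8) (Fin 8) ℝ) : E8 →ₗ[ℝ] E8 :=
  (WithLp.linearEquiv 2 ℝ (Fin 8 → ℝ)).symm.toLinearMap ∘ₗ
    g.mulVecLin ∘ₗ (WithLp.linearEquiv 2 ℝ (Fin 8 → ℝ)).toLinearMap

/-- The action of a matrix `g` on 4-forms: `(g·ω)(v₁,…,v₄) = ω(g⁻¹v₁,…,g⁻¹v₄)`. -/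
def formAct (g : Matrix (Fin 8) (Fin 8) ℝ) (ω : Form4) : Form4 :=
  ω.compLinearMap (mulVecL g⁻¹)

/-- Two 4-forms are `SO(8)`-conjugate if they lie in the same orbit. -/
def SOConj (ω η : Form4) : Prop := ∃ g, IsSO8 g ∧ formAct g ω = η

lemma vec_four_eta {α : Type*} (v : Fin 4 → α) : v = ![v 0, v 1, v 2, v 3] := by
  ext i
  fin_cases i <;> rfl

lemma update_two {α : Type*} (p q r s t : α) :
    Function.update ![p, q, r, s] 2 t = ![p, q, t, s] := by
  ext i
  fin_cases i <;> rfl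

lemma update_three {α : Type*} (p q r s t : α) :
    Function.update ![p, q, r, s] 3 t = ![p, q, r, t] := by
  ext i
  fin_cases i <;> rfl

lemma wedge4_apply (a b c d : Fin 8) (v : Fin 4 → E8) :
    wedge4 a b c d v = (Matrix.of fun i j : Fin 4 => v i (![a, b, c, d] j)).det := rfl

/-- The spinorial cross product `ℝ⁸ × ℝ⁸ → ℝ⁷`, which is `2π₇` on decomposable bivectors, where
`π₇` is the projection of `Λ²ℝ⁸` onto its seven-dimensional `Spin(7)`-irreducible summand. -/
def cross (x y : E8) : EuclideanSpace ℝ (Fin 7) :=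
  let p : Fin 8 → Fin 8 → ℝ := fun i j => x i * y j - x j * y i
  !₂[p 0 1 + p 2 3 + p 4 5 + p 6 7,
    p 0 2 - p 1 3 + p 4 6 - p 5 7,
    p 0 3 + p 1 2 - p 4 7 - p 5 6,
    p 0 4 - p 1 5 - p 2 6 + p 3 7,
    p 0 5 + p 1 4 + p 2 7 + p 3 6,
    p 0 6 - p 1 7 + p 2 4 - p 3 5,
    p 0 7 + p 1 6 - p 2 5 - p 3 4]

set_option maxHeartbeats 4000000 in
/-- The Cayley form as the defect of `cross` from being isometric on bivectors. -/
lemma inner_cross_cross (x y z w : E8) :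
    inner ℝ (cross x y) (cross z w) =
      cay ![x, y, z, w] + (inner ℝ x z * inner ℝ y w - inner ℝ x w * inner ℝ y z) := by
  simp only [cay, E1234, E1256, E1278, E1357, E1467, E1368, E1458, AlternatingMap.add_apply,
    AlternatingMap.sub_apply, wedge4_apply, PiLp.inner_apply, RCLike.inner_apply, conj_trivial,
    cross]
  simp [Fin.sum_univ_succ, Matrix.det_succ_row_zero, Fin.succAbove]
  ring

lemma norm_cross_le (x y : E8) : ‖cross x y‖ ≤ ‖x‖ * ‖y‖ := by
  have h := inner_cross_cross x y x y
  have hcay : cay ![x, y, x, y] = 0 :=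
    cay.map_eq_zero_of_eq _ (i := 0) (j := 2) rfl (by decide)
  rw [hcay, real_inner_self_eq_norm_sq, real_inner_self_eq_norm_sq, real_inner_self_eq_norm_sq,
    real_inner_comm x y] at h
  refine abs_le_of_sq_le_sq' ?_ (by positivity) |>.2
  nlinarith [sq_nonneg (inner ℝ x y)]

/-- A vector differs from one of no greater norm orthogonal to `x` and `y` by a combination of `x`
and `y`. -/
lemma exists_eq_add_orthogonal_pair (x y z : E8) :
    ∃ (a b : ℝ) (z' : E8), z = a • x + b • y + z' ∧ inner ℝ x z' = 0 ∧ inner ℝ y z' = 0 ∧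
      ‖z'‖ ≤ ‖z‖ := by
  set K := Submodule.span ℝ {x, y}
  have hx : x ∈ K := Submodule.subset_span (by simp)
  have hy : y ∈ K := Submodule.subset_span (by simp)
  obtain ⟨u, hu, z', hz', rfl⟩ := K.exists_add_mem_mem_orthogonal z
  obtain ⟨a, b, rfl⟩ := Submodule.mem_span_pair.mp hu
  refine ⟨a, b, z', rfl, hz' x hx, hz' y hy, ?_⟩
  have h := norm_add_sq_eq_norm_sq_add_norm_sq_of_inner_eq_zero _ _ (hz' _ hu)
  refine abs_le_of_sq_le_sq' ?_ (norm_nonneg _) |>.2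
  nlinarith [mul_self_nonneg ‖a • x + b • y‖]

lemma form4_update_smul_add_smul_add (ω : Form4) (v : Fin 4 → E8) {i j k : Fin 4}
    (hj : i ≠ j) (hk : i ≠ k) (s t : ℝ) (u : E8) :
    ω (Function.update v i (s • v j + t • v k + u)) = ω (Function.update v i u) := by
  rw [ω.map_update_add, ω.map_update_add, ω.map_update_smul, ω.map_update_smul,
    ω.map_update_self v hj, ω.map_update_self v hk]
  simp

lemma form4_add_smul_add_smul (ω : Form4) (x y z w : E8) (a b c d : ℝ) :
    ω ![x, y, a • x + b • y + z, c • x + d • y + w] = ω ![x, y, z, w] := by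
  have h₂ := form4_update_smul_add_smul_add ω ![x, y, z, c • x + d • y + w]
    (i := 2) (j := 0) (k := 1) (by decide) (by decide) a b z
  have h₃ := form4_update_smul_add_smul_add ω ![x, y, z, w]
    (i := 3) (j := 0) (k := 1) (by decide) (by decide) c d w
  rw [update_two, update_two] at h₂
  rw [update_three, update_three] at h₃
  exact h₂.trans h₃

lemma cay_le (x y z w : E8) : cay ![x, y, z, w] ≤ ‖x‖ * ‖y‖ * (‖z‖ * ‖w‖) := by
  obtain ⟨a, b, z', hz, hxz, hyz, hnz⟩ := exists_eq_add_orthogonal_pair x y z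
  obtain ⟨c, d, w', hw, hxw, hyw, hnw⟩ := exists_eq_add_orthogonal_pair x y w
  calc cay ![x, y, z, w] = inner ℝ (cross x y) (cross z' w') := by
        rw [hz, hw, form4_add_smul_add_smul, inner_cross_cross, hxz, hxw]
        simp
    _ ≤ ‖cross x y‖ * ‖cross z' w'‖ := real_inner_le_norm _ _
    _ ≤ ‖x‖ * ‖y‖ * (‖z'‖ * ‖w'‖) := by
        gcongr
        · exact norm_cross_le x y
        · exact norm_cross_le z' w'
    _ ≤ ‖x‖ * ‖y‖ * (‖z‖ * ‖w‖) := by gcongr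

/-- The increasing multi-indices at which the Cayley form does not vanish. -/
def cayIndex : Fin 14 → Fin 4 → Fin 8 :=
  ![![0, 1, 2, 3], ![4, 5, 6, 7], ![0, 1, 4, 5], ![2, 3, 6, 7], ![0, 1, 6, 7], ![2, 3, 4, 5],
    ![0, 2, 4, 6], ![1, 3, 5, 7], ![0, 2, 5, 7], ![1, 3, 4, 6], ![0, 3, 4, 7], ![1, 2, 5, 6],
    ![0, 3, 5, 6], ![1, 2, 4, 7]]

/-- The coefficients of the Cayley form at the multi-indices `cayIndex`. -/
def cayCoeff : Fin 14 → ℝ := fun k => if k < 8 then 1 else -1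

lemma cayIndex_strictMono (k : Fin 14) : StrictMono (cayIndex k) := by
  rw [Fin.strictMono_iff_lt_succ]
  revert k
  decide

lemma cayIndex_injective : Function.Injective cayIndex := by decide

lemma wedge4_stdB {f g : Fin 4 → Fin 8} (hf : StrictMono f) (hg : StrictMono g) :
    wedge4 (g 0) (g 1) (g 2) (g 3) (fun i => stdB (f i)) = if f = g then 1 else 0 := by
  have hentry : (Matrix.of fun i j : Fin 4 => stdB (f i) (g j)) =
      Matrix.of fun i j => if g j = f i then (1 : ℝ) else 0 := by
    ext i j
    simp [stdB]
  rw [wedge4_apply, ← vec_four_eta, hentry]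
  split_ifs with h
  · subst h
    convert Matrix.det_one (R := ℝ) (n := Fin 4)
    ext i j
    simp [Matrix.one_apply, hf.injective.eq_iff, eq_comm]
  · rw [Matrix.det_apply]
    refine Finset.sum_eq_zero fun σ _ => ?_
    obtain ⟨i, hi⟩ : ∃ i, g i ≠ f (σ i) := by
      by_contra! hσ
      refine h (hf.range_inj hg |>.mp ?_)
      rw [show g = f ∘ σ from funext hσ, σ.surjective.range_comp]
    rw [Finset.prod_eq_zero (Finset.mem_univ i) (by simp [hi]), smul_zero]

lemma cay_stdB {f : Fin 4 → Fin 8} (hf : StrictMono f) :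
    cay (fun i => stdB (f i)) = ∑ k, if f = cayIndex k then cayCoeff k else 0 := by
  have hcay (v : Fin 4 → E8) : cay v = ∑ k, cayCoeff k *
      wedge4 (cayIndex k 0) (cayIndex k 1) (cayIndex k 2) (cayIndex k 3) v := by
    simp [cay, E1234, E1256, E1278, E1357, E1467, E1368, E1458, Fin.sum_univ_succ, cayIndex,
      cayCoeff]
    ring
  simp [hcay, wedge4_stdB hf (cayIndex_strictMono _)]

lemma cay_stdB_cayIndex (k : Fin 14) : cay (fun i => stdB (cayIndex k i)) = cayCoeff k := by
  simp [cay_stdB (cayIndex_strictMono k), cayIndex_injective.eq_iff]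

lemma comass_cay : comass cay = 1 := by
  refine IsGreatest.csSup_eq (a := 1) ⟨?_, ?_⟩
  · refine ⟨fun i => stdB (cayIndex 0 i), fun i => by simp [stdB], ?_⟩
    rw [cay_stdB_cayIndex]
    simp [cayCoeff]
  · rintro r ⟨v, hv, hr⟩
    have hcay : cay ![v 0, v 1, v 2, v 3] = cay v := by rw [← vec_four_eta v]
    have h := (hr.symm.trans hcay.symm).trans_le (cay_le (v 0) (v 1) (v 2) (v 3))
    simpa [hv] using h

lemma eNormSq_cay : eNormSq cay = 14 := by
  classical
  have hsub : Finset.univ.image cayIndex ⊆ Finset.univ.filter StrictMono := by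
    intro f hf
    obtain ⟨k, -, rfl⟩ := Finset.mem_image.mp hf
    simpa using cayIndex_strictMono k
  have hsum : ∑ f ∈ Finset.univ.image cayIndex, cay (fun i => stdB (f i)) ^ 2 = 14 := by
    rw [Finset.sum_image cayIndex_injective.injOn]
    have hsq (k : Fin 14) : cayCoeff k ^ 2 = 1 := by
      unfold cayCoeff
      split_ifs <;> norm_num
    simp [cay_stdB_cayIndex, hsq]
  rw [← hsum, eNormSq]
  symm
  convert Finset.sum_subset hsub fun f hf hf' => ?_
  rw [cay_stdB (by simpa using hf), Finset.sum_eq_zero, sq, mul_zero]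
  intro k _
  rw [if_neg]
  rintro rfl
  exact hf' (Finset.mem_image_of_mem _ (Finset.mem_univ k))

/-- The Cayley form has comass `1`, Euclidean norm squared `14`, and hence
Wirtinger ratio `|cay|²/‖cay‖² = 14`. -/
theorem cayley_comass_one_normSq_fourteen :
    comass cay = 1 ∧ eNormSq cay = 14 ∧ eNormSq cay / comass cay ^ 2 = 14 := by
  exact ⟨comass_cay, eNormSq_cay, by rw [comass_cay, eNormSq_cay]; norm_num⟩
end
end

section
/- Every alternating 4-form ω on ℝ⁸ satisfies |ω|² ≤ 14·‖ω‖², where |·| is the Euclidean norm and ‖·‖ is the comass; i.e. 14 is the maximal possible value of the Wirtinger ratio |ω|²/‖ω‖² for 4-forms on ℝ⁸. -/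
noncomputable section

open scoped BigOperators
open Matrix

open scoped RealInnerProductSpace

section

variable {E : Type*} [NormedAddCommGroup E] [InnerProductSpace ℝ E]

/-- Bessel's inequality for a linear functional bounded by `C` on the unit sphere. -/
theorem LinearMap.sum_sq_le_of_orthonormal {ι : Type*} [Fintype ι] (φ : E →ₗ[ℝ] ℝ) {C : ℝ}
    (hφ : ∀ x, ‖x‖ = 1 → φ x ≤ C) {v : ι → E} (hv : Orthonormal ℝ v) :
    ∑ i, φ (v i) ^ 2 ≤ C ^ 2 := by
  set S := ∑ i, φ (v i) ^ 2 with hS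
  have hS0 : 0 ≤ S := Finset.sum_nonneg fun i _ => sq_nonneg _
  rcases hS0.eq_or_lt with h0 | hpos
  · rw [← h0]; positivity
  set x := ∑ i, φ (v i) • v i with hx
  have hφx : φ x = S := by simp [hx, hS, sq]
  have hnx : ‖x‖ ^ 2 = S := by
    rw [← real_inner_self_eq_norm_sq, hx, hv.inner_sum]
    simp [hS, sq]
  have hx0 : 0 < ‖x‖ := by
    rw [norm_pos_iff]
    rintro h
    rw [h] at hnx
    simp at hnx
    exact hpos.ne hnx
  have h1 : φ (‖x‖⁻¹ • x) ≤ C := hφ _ (by rw [norm_smul, norm_inv, norm_norm]; field_simp)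
  rw [map_smul, hφx, smul_eq_mul, ← hnx] at h1
  have h2 : ‖x‖ ≤ C := by
    calc ‖x‖ = ‖x‖⁻¹ * ‖x‖ ^ 2 := by field_simp
      _ ≤ C := h1
  rw [← hnx]
  gcongr

/-- Parseval: the sum of the squares of a linear functional over an orthonormal basis does not
depend on the basis. -/
theorem LinearMap.sum_sq_orthonormalBasis_eq {ι κ : Type*} [Fintype ι] [Fintype κ]
    (φ : E →ₗ[ℝ] ℝ) (b : OrthonormalBasis ι ℝ E) (c : OrthonormalBasis κ ℝ E) :
    ∑ i, φ (b i) ^ 2 = ∑ k, φ (c k) ^ 2 := by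
  have : FiniteDimensional ℝ E := b.toBasis.finiteDimensional_of_finite
  set w := (InnerProductSpace.toDual ℝ E).symm (LinearMap.toContinuousLinearMap φ) with hw
  have h : ∀ x, φ x = ⟪w, x⟫ := fun x => by
    rw [hw, InnerProductSpace.toDual_symm_apply]; rfl
  simp only [h, OrthonormalBasis.sum_sq_inner_left]

/-- A linear functional attaining its maximum over the unit sphere at `v` is proportional to the
inner product with `v`. -/
theorem LinearMap.eq_mul_inner_of_le [FiniteDimensional ℝ E] (φ : E →ₗ[ℝ] ℝ) {v : E}
    (hv : ‖v‖ = 1) (hφ : ∀ x, ‖x‖ = 1 → φ x ≤ φ v) (x : E) : φ x = φ v * ⟪v, x⟫ := by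
  set w := (InnerProductSpace.toDual ℝ E).symm (LinearMap.toContinuousLinearMap φ) with hw
  have h : ∀ x, φ x = ⟪w, x⟫ := fun x => by
    rw [hw, InnerProductSpace.toDual_symm_apply]; rfl
  have hwn : ‖w‖ ^ 2 ≤ φ v ^ 2 := by
    rw [← (stdOrthonormalBasis ℝ E).sum_sq_inner_left]
    simp only [← h]
    exact φ.sum_sq_le_of_orthonormal hφ (stdOrthonormalBasis ℝ E).orthonormal
  have hz : w - φ v • v = 0 := by
    have h2 := norm_sub_sq_real w (φ v • v)
    rw [inner_smul_right, ← h, norm_smul, hv, mul_one, Real.norm_eq_abs, sq_abs] at h2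
    have : ‖w - φ v • v‖ ^ 2 ≤ 0 := by nlinarith
    exact norm_eq_zero.1 (pow_eq_zero_iff two_ne_zero |>.1 (le_antisymm this (sq_nonneg _)))
  rw [h x, sub_eq_zero.1 hz, inner_smul_left]
  simp

theorem Function.comp_vecCons {α β : Type*} {n : ℕ} (g : α → β) (a : α) (f : Fin n → α) :
    g ∘ Matrix.vecCons a f = Matrix.vecCons (g a) (g ∘ f) :=
  Fin.comp_cons g a f

theorem Fin.sum_univ_pi_succ {M ι : Type*} [AddCommMonoid M] [Fintype ι] {n : ℕ}
    (F : (Fin (n + 1) → ι) → M) :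
    ∑ f, F f = ∑ a, ∑ f : Fin n → ι, F (Matrix.vecCons a f) := by
  rw [← (Fin.consEquiv fun _ => ι).sum_comp, Fintype.sum_prod_type]
  rfl

theorem Fin.sum_univ_pi_zero {M ι : Type*} [AddCommMonoid M] [Fintype ι]
    (F : (Fin 0 → ι) → M) : ∑ f, F f = F ![] :=
  Fintype.sum_subsingleton _ ![]

/-- The sum of the squares of the components of a multilinear form does not depend on the
orthonormal basis. -/
theorem MultilinearMap.sum_sq_orthonormalBasis_eq {ι κ : Type*} [Fintype ι] [Fintype κ] {n : ℕ}
    (ω : MultilinearMap ℝ (fun _ : Fin n => E) ℝ) (b : OrthonormalBasis ι ℝ E)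
    (c : OrthonormalBasis κ ℝ E) :
    ∑ f : Fin n → ι, ω (b ∘ f) ^ 2 = ∑ f : Fin n → κ, ω (c ∘ f) ^ 2 := by
  induction n with
  | zero => simp [Subsingleton.elim _ (![] : Fin 0 → E)]
  | succ n ih =>
    have hb : ∀ (a : E) (f : Fin n → E), ω (Matrix.vecCons a f) = ω.curryLeft a f := fun _ _ => rfl
    have key : ∀ f : Fin n → κ, ∑ a, ω.curryLeft (b a) (c ∘ f) ^ 2 =
        ∑ a, ω.curryLeft (c a) (c ∘ f) ^ 2 := fun f =>
      LinearMap.sum_sq_orthonormalBasis_eq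
        { toFun := fun x => ω.curryLeft x (c ∘ f)
          map_add' := by simp only [map_add, _root_.add_apply, implies_true]
          map_smul' := by
            simp only [map_smul, _root_.smul_apply, RingHom.id_apply, implies_true] } b c
    simp only [Fin.sum_univ_pi_succ, Function.comp_vecCons, hb, ih]
    rw [Finset.sum_comm, Finset.sum_comm (γ := κ)]
    simp only [key]

variable [FiniteDimensional ℝ E]

theorem AlternatingMap.continuous_apply_of_finiteDimensional {n : ℕ} (ω : E [⋀^Fin n]→ₗ[ℝ] ℝ) :
    Continuous fun v : Fin n → E => ω v := by
  set b := stdOrthonormalBasis ℝ E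
  have h : ∀ v : Fin n → E, ω v = ∑ f : Fin n → Fin (Module.finrank ℝ E),
      (∏ i, ⟪b (f i), v i⟫) * ω (fun i => b (f i)) := fun v => by
    conv_lhs => rw [← funext fun i => b.sum_repr' (v i)]
    simp only [← AlternatingMap.coe_multilinearMap, MultilinearMap.map_sum,
      MultilinearMap.map_smul_univ, smul_eq_mul]
  rw [funext h]
  fun_prop

/-- An alternating form attains its maximum over tuples of unit vectors at `v`: then its partial
functionals at `v` are proportional to the inner products with the entries of `v`. -/
theorem AlternatingMap.update_eq_mul_inner {n : ℕ} (ω : E [⋀^Fin n]→ₗ[ℝ] ℝ) {v : Fin n → E}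
    (hv : ∀ i, ‖v i‖ = 1) (hmax : ∀ u : Fin n → E, (∀ i, ‖u i‖ = 1) → ω u ≤ ω v)
    (i : Fin n) (x : E) : ω (Function.update v i x) = ω v * ⟪v i, x⟫ := by
  have h := (ω.toMultilinearMap.toLinearMap v i).eq_mul_inner_of_le (hv i) (fun y hy => by
    simp only [MultilinearMap.toLinearMap_apply, Function.update_eq_self]
    refine hmax _ fun j => ?_
    rcases eq_or_ne j i with rfl | hj
    · simpa using hy
    · simpa [hj] using hv j) x
  simpa using h

/-- The maximum of an alternating form over tuples of unit vectors is attained at an orthonormal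
tuple. -/
theorem AlternatingMap.exists_orthonormal_forall_le {n : ℕ} (hn : n + 1 ≤ Module.finrank ℝ E)
    (ω : E [⋀^Fin (n + 1)]→ₗ[ℝ] ℝ) :
    ∃ v : Fin (n + 1) → E, Orthonormal ℝ v ∧
      ∀ u : Fin (n + 1) → E, (∀ i, ‖u i‖ = 1) → ω u ≤ ω v := by
  set v₀ : Fin (n + 1) → E := fun i => stdOrthonormalBasis ℝ E (Fin.castLE hn i) with hv₀
  have ho : Orthonormal ℝ v₀ :=
    (stdOrthonormalBasis ℝ E).orthonormal.comp _ (Fin.castLE_injective hn)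
  obtain ⟨v, hv, hmax⟩ :=
    (isCompact_univ_pi fun _ : Fin (n + 1) => isCompact_sphere (0 : E) 1).exists_isMaxOn
      ⟨v₀, by simpa using ho.1⟩ ω.continuous_apply_of_finiteDimensional.continuousOn
  have hv1 : ∀ i, ‖v i‖ = 1 := by simpa using hv
  have hmax1 : ∀ u : Fin (n + 1) → E, (∀ i, ‖u i‖ = 1) → ω u ≤ ω v :=
    fun u hu => hmax (by simpa using hu)
  by_cases h0 : ω v = 0
  · refine ⟨v₀, ho, fun u hu => (hmax1 u hu).trans ?_⟩
    have h1 := hmax1 (Function.update v₀ 0 (-v₀ 0)) fun j => by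
      rcases eq_or_ne j 0 with rfl | hj
      · simpa using ho.1 0
      · simpa [hj] using ho.1 j
    rw [ω.map_update_neg, Function.update_eq_self] at h1
    linarith
  · refine ⟨v, ⟨hv1, fun i j hij => ?_⟩, hmax1⟩
    have h1 := ω.update_eq_mul_inner hv1 hmax1 i (v j)
    rw [ω.map_update_self _ hij] at h1
    exact (mul_eq_zero.1 h1.symm).resolve_left h0

end

section

variable {E : Type*} [NormedAddCommGroup E] [InnerProductSpace ℝ E]

theorem Matrix.comp_vecEmpty {α β : Type*} (g : α → β) : g ∘ ![] = ![] :=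
  Subsingleton.elim _ _

theorem AlternatingMap.map_vecFour_swap_zero_one (ω : E [⋀^Fin 4]→ₗ[ℝ] ℝ) (a b c d : E) :
    ω ![b, a, c, d] = -ω ![a, b, c, d] := by
  rw [← ω.map_swap _ (show (0 : Fin 4) ≠ 1 by decide)]
  congr 1
  ext i
  fin_cases i <;> rfl

theorem AlternatingMap.map_vecFour_swap_one_two (ω : E [⋀^Fin 4]→ₗ[ℝ] ℝ) (a b c d : E) :
    ω ![a, c, b, d] = -ω ![a, b, c, d] := by
  rw [← ω.map_swap _ (show (1 : Fin 4) ≠ 2 by decide)]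
  congr 1
  ext i
  fin_cases i <;> rfl

theorem AlternatingMap.map_vecFour_swap_two_three (ω : E [⋀^Fin 4]→ₗ[ℝ] ℝ) (a b c d : E) :
    ω ![a, b, d, c] = -ω ![a, b, c, d] := by
  rw [← ω.map_swap _ (show (2 : Fin 4) ≠ 3 by decide)]
  congr 1
  ext i
  fin_cases i <;> rfl

/-- Bessel's inequality in the first slot of a 4-form, along three orthonormal vectors. -/
theorem AlternatingMap.sq_add_sq_add_sq_le (ω : E [⋀^Fin 4]→ₗ[ℝ] ℝ) {C : ℝ}
    (hC : ∀ u : Fin 4 → E, (∀ i, ‖u i‖ = 1) → ω u ≤ C) {x p q : E} (hx : ‖x‖ = 1)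
    (hp : ‖p‖ = 1) (hq : ‖q‖ = 1) {v : Fin 3 → E} (hv : Orthonormal ℝ v) :
    ω ![v 0, x, p, q] ^ 2 + ω ![v 1, x, p, q] ^ 2 + ω ![v 2, x, p, q] ^ 2 ≤ C ^ 2 := by
  have hφ : ∀ z, ω.toMultilinearMap.toLinearMap ![0, x, p, q] 0 z = ω ![z, x, p, q] := fun z => by
    change ω _ = _
    congr 1
    ext i
    fin_cases i <;> rfl
  have h := (ω.toMultilinearMap.toLinearMap ![0, x, p, q] 0).sum_sq_le_of_orthonormal
    (C := C) (fun z hz => by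
      rw [hφ]
      exact hC _ fun i => by fin_cases i <;> simpa) hv
  simpa only [hφ, Fin.sum_univ_three] using h

/-- The sum of a symmetric function of three indices in `Fin 4` vanishing on the diagonals. -/
theorem Fin.sum_sum_sum_four_of_symm (F : Fin 4 → Fin 4 → Fin 4 → ℝ)
    (h₁ : ∀ a b c, F b a c = F a b c) (h₂ : ∀ a b c, F a c b = F a b c)
    (h₀ : ∀ a b, F a a b = 0) :
    ∑ k, ∑ l, ∑ m, F k l m = 6 * (F 0 1 2 + F 0 1 3 + F 0 2 3 + F 1 2 3) := by
  have h₃ : ∀ a b, F a b b = 0 := fun a b => by rw [h₁, h₂, h₀]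
  have h₄ : ∀ a b, F a b a = 0 := fun a b => by rw [h₂, h₀]
  simp only [Fin.sum_univ_four, h₀, h₃, h₄]
  linarith [h₁ 0 1 2, h₁ 0 1 3, h₁ 0 2 3, h₁ 1 2 3, h₁ 0 2 1, h₁ 0 3 1, h₁ 0 3 2, h₁ 1 3 2,
    h₁ 1 2 0, h₁ 1 3 0, h₁ 2 3 0, h₁ 2 3 1, h₂ 0 1 2, h₂ 0 1 3, h₂ 0 2 3, h₂ 1 2 3, h₂ 1 0 2,
    h₂ 1 0 3, h₂ 2 0 3, h₂ 2 1 3, h₂ 2 0 1, h₂ 3 0 1, h₂ 3 0 2, h₂ 3 1 2]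

theorem orthonormal_vecThree {p q r : E} (hp : ‖p‖ = 1) (hq : ‖q‖ = 1) (hr : ‖r‖ = 1)
    (hpq : ⟪p, q⟫ = 0) (hpr : ⟪p, r⟫ = 0) (hqr : ⟪q, r⟫ = 0) : Orthonormal ℝ ![p, q, r] := by
  refine ⟨fun i => by fin_cases i <;> simpa, fun i j hij => ?_⟩
  fin_cases i <;> fin_cases j <;>
    first
    | exact absurd rfl hij
    | simpa using by first | assumption | (rw [real_inner_comm]; assumption)

/-- The estimate of `AlternatingMap.six_mul_sum_add_sum_le` in an orthonormal tuple `g` in which the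
2-form `ω(x, y, ·, ·)` is block diagonal. -/
theorem AlternatingMap.six_mul_sum_add_sum_le_of_normalForm (ω : E [⋀^Fin 4]→ₗ[ℝ] ℝ) {C : ℝ}
    (hC : ∀ u : Fin 4 → E, (∀ i, ‖u i‖ = 1) → ω u ≤ C) {x y : E} (hx : ‖x‖ = 1)
    (hy : ‖y‖ = 1) {g : Fin 4 → E} (hg : Orthonormal ℝ g) (hxg : ∀ k, ⟪x, g k⟫ = 0)
    (hyg : ∀ k, ⟪y, g k⟫ = 0)
    (h02 : ω ![x, y, g 0, g 2] = 0) (h03 : ω ![x, y, g 0, g 3] = 0)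
    (h12 : ω ![x, y, g 1, g 2] = 0) (h13 : ω ![x, y, g 1, g 3] = 0) :
    6 * ∑ k, ∑ l, ω ![x, y, g k, g l] ^ 2 + ∑ k, ∑ l, ∑ m, ω ![x, g k, g l, g m] ^ 2 +
      ∑ k, ∑ l, ∑ m, ω ![y, g k, g l, g m] ^ 2 ≤ 24 * C ^ 2 := by
  have hsum : ∀ z, ∑ k, ∑ l, ∑ m, ω ![z, g k, g l, g m] ^ 2 = 6 * (ω ![z, g 0, g 1, g 2] ^ 2 +
      ω ![z, g 0, g 1, g 3] ^ 2 + ω ![z, g 0, g 2, g 3] ^ 2 + ω ![z, g 1, g 2, g 3] ^ 2) := fun z =>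
    Fin.sum_sum_sum_four_of_symm (fun k l m => ω ![z, g k, g l, g m] ^ 2)
      (fun a b c => by simp only [ω.map_vecFour_swap_one_two _ (g a) (g b), neg_sq])
      (fun a b c => by simp only [ω.map_vecFour_swap_two_three _ _ (g b) (g c), neg_sq])
      (fun a b => by
        simp only [ω.map_eq_zero_of_eq ![z, g a, g a, g b] (i := 1) (j := 2) rfl (by decide)]
        simp)
  have hpair : ∑ k, ∑ l, ω ![x, y, g k, g l] ^ 2 =
      2 * (ω ![x, y, g 0, g 1] ^ 2 + ω ![x, y, g 2, g 3] ^ 2) := by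
    have h0 : ∀ k, ω ![x, y, g k, g k] = 0 := fun k =>
      ω.map_eq_zero_of_eq _ (i := 2) (j := 3) rfl (by decide)
    have hs : ∀ k l, ω ![x, y, g l, g k] = -ω ![x, y, g k, g l] := fun k l =>
      ω.map_vecFour_swap_two_three _ _ _ _
    simp only [Fin.sum_univ_four, h0, hs 0 1, hs 0 2, hs 0 3, hs 1 2, hs 1 3, hs 2 3, h02, h03,
      h12, h13]
    ring
  have bessel : ∀ {p q : E} {a b c d : Fin 4}, ‖p‖ = 1 → ‖q‖ = 1 → (∀ k, ⟪p, g k⟫ = 0) → a ≠ b →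
      ω ![p, q, g c, g d] ^ 2 + ω ![q, g a, g c, g d] ^ 2 + ω ![q, g b, g c, g d] ^ 2 ≤ C ^ 2 := by
    intro p q a b c d hp hq hpg hab
    have := ω.sq_add_sq_add_sq_le hC hq (hg.1 c) (hg.1 d)
      (orthonormal_vecThree hp (hg.1 a) (hg.1 b) (hpg a) (hpg b) (hg.2 hab))
    simpa [ω.map_vecFour_swap_zero_one q (g a), ω.map_vecFour_swap_zero_one q (g b)] using this
  have b₁ := bessel (a := 2) (b := 3) (c := 0) (d := 1) hx hy hxg (by decide)
  have b₂ := bessel (a := 2) (b := 3) (c := 0) (d := 1) hy hx hyg (by decide)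
  have b₃ := bessel (a := 0) (b := 1) (c := 2) (d := 3) hx hy hxg (by decide)
  have b₄ := bessel (a := 0) (b := 1) (c := 2) (d := 3) hy hx hyg (by decide)
  have hr : ∀ z k l m, ω ![z, g m, g k, g l] = ω ![z, g k, g l, g m] := fun z k l m => by
    rw [ω.map_vecFour_swap_one_two, ω.map_vecFour_swap_two_three, neg_neg]
  rw [ω.map_vecFour_swap_zero_one x y, neg_sq] at b₂ b₄
  rw [hr, hr _ 0 1 3] at b₁ b₂
  rw [hsum, hsum, hpair]
  linarith

/-- A 2-form on `ℝ⁴` is block diagonal in some orthonormal basis. -/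
theorem AlternatingMap.exists_orthonormalBasis_normalForm
    (η : EuclideanSpace ℝ (Fin 4) [⋀^Fin 2]→ₗ[ℝ] ℝ) :
    ∃ g : OrthonormalBasis (Fin 4) ℝ (EuclideanSpace ℝ (Fin 4)),
      η ![g 0, g 2] = 0 ∧ η ![g 0, g 3] = 0 ∧ η ![g 1, g 2] = 0 ∧ η ![g 1, g 3] = 0 := by
  obtain ⟨v, hv, hmax⟩ := η.exists_orthonormal_forall_le (by simp)
  obtain ⟨g, hg⟩ := Orthonormal.exists_orthonormalBasis_extension_of_card_eq
    (𝕜 := ℝ) (E := EuclideanSpace ℝ (Fin 4)) (ι := Fin 4) (by simp)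
    (v := ![v 0, v 1, 0, 0]) (s := {0, 1}) (by
      refine ⟨?_, ?_⟩
      · rintro ⟨i, rfl | rfl⟩
        · simpa using hv.1 0
        · simpa using hv.1 1
      · rintro ⟨i, rfl | rfl⟩ ⟨j, rfl | rfl⟩ hij
        · exact absurd rfl hij
        · simpa using hv.2 (show (0 : Fin 2) ≠ 1 by decide)
        · simpa using hv.2 (show (1 : Fin 2) ≠ 0 by decide)
        · exact absurd rfl hij)
  have h0 : g 0 = v 0 := hg 0 (by simp)
  have h1 : g 1 = v 1 := hg 1 (by simp)
  have H := η.update_eq_mul_inner hv.1 hmax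
  have H0 : ∀ z, ⟪g 1, z⟫ = 0 → η ![g 0, z] = 0 := fun z hz => by
    have := H 1 z
    rw [← h1, hz, mul_zero] at this
    rw [← this, h0]
    congr 1
    ext i
    fin_cases i <;> rfl
  have H1 : ∀ z, ⟪g 0, z⟫ = 0 → η ![g 1, z] = 0 := fun z hz => by
    have := H 0 z
    rw [← h0, hz, mul_zero, ← neg_eq_zero, ← η.map_swap _ (show (0 : Fin 2) ≠ 1 by decide)] at this
    rw [← this, h1]
    congr 1
    ext i
    fin_cases i <;> rfl
  exact ⟨g, H0 _ (g.orthonormal.2 (by decide)), H0 _ (g.orthonormal.2 (by decide)),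
    H1 _ (g.orthonormal.2 (by decide)), H1 _ (g.orthonormal.2 (by decide))⟩

/-- For unit vectors `x`, `y` orthogonal to an orthonormal tuple `f`, a bound on the components of
`ω(x, y, ·, ·)`, `ω(x, ·, ·, ·)` and `ω(y, ·, ·, ·)` along `f` by the comass. -/
theorem AlternatingMap.six_mul_sum_add_sum_le (ω : E [⋀^Fin 4]→ₗ[ℝ] ℝ) {C : ℝ}
    (hC : ∀ u : Fin 4 → E, (∀ i, ‖u i‖ = 1) → ω u ≤ C) {x y : E} (hx : ‖x‖ = 1)
    (hy : ‖y‖ = 1) {f : Fin 4 → E} (hf : Orthonormal ℝ f) (hxf : ∀ k, ⟪x, f k⟫ = 0)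
    (hyf : ∀ k, ⟪y, f k⟫ = 0) :
    6 * ∑ k, ∑ l, ω ![x, y, f k, f l] ^ 2 + ∑ k, ∑ l, ∑ m, ω ![x, f k, f l, f m] ^ 2 +
      ∑ k, ∑ l, ∑ m, ω ![y, f k, f l, f m] ^ 2 ≤ 24 * C ^ 2 := by
  set c := EuclideanSpace.basisFun (Fin 4) ℝ
  set L : EuclideanSpace ℝ (Fin 4) →ₗ[ℝ] E := c.toBasis.constr ℝ f with hL
  have hLc : ∀ k, L (c k) = f k := fun k => by
    rw [hL, ← c.coe_toBasis, Module.Basis.constr_basis]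
  set J := L.isometryOfOrthonormal (v := c.toBasis) (by simp)
    (by convert hf using 1; ext1 k; simpa using hLc k) with hJ
  have hJc : ∀ k, J (c k) = f k := hLc
  have hperp : ∀ {z : E}, (∀ k, ⟪z, f k⟫ = 0) → ∀ w, ⟪z, J w⟫ = 0 := fun {z} hz w => by
    rw [← c.sum_repr w, map_sum, inner_sum]
    simp [hJc, hz, inner_smul_right]
  set η := ((ω.curryLeft x).curryLeft y).compLinearMap J.toLinearMap with hη
  have hη' : ∀ p q, η ![p, q] = ω ![x, y, J p, J q] := fun p q => by
    simp only [hη, AlternatingMap.compLinearMap_apply, AlternatingMap.curryLeft_apply_apply]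
    congr 1
    ext i
    fin_cases i <;> rfl
  have hτ : ∀ z p q r, (ω.curryLeft z).compLinearMap J.toLinearMap ![p, q, r] =
      ω ![z, J p, J q, J r] := fun z p q r => by
    simp only [AlternatingMap.compLinearMap_apply, AlternatingMap.curryLeft_apply_apply]
    congr 1
    ext i
    fin_cases i <;> rfl
  obtain ⟨g, h02, h03, h12, h13⟩ := η.exists_orthonormalBasis_normalForm
  rw [hη'] at h02 h03 h12 h13
  have key := ω.six_mul_sum_add_sum_le_of_normalForm hC hx hy (g := fun k => J (g k))
    (g.orthonormal.comp_linearIsometry J) (fun k => hperp hxf _) (fun k => hperp hyf _)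
    h02 h03 h12 h13
  have e₁ := η.toMultilinearMap.sum_sq_orthonormalBasis_eq g c
  have e₂ := fun z => ((ω.curryLeft z).compLinearMap
    J.toLinearMap).toMultilinearMap.sum_sq_orthonormalBasis_eq g c
  simp only [Fin.sum_univ_pi_succ, Fin.sum_univ_pi_zero, Function.comp_vecCons,
    Matrix.comp_vecEmpty, AlternatingMap.coe_multilinearMap, hη', hτ, hJc] at e₁ e₂
  rwa [e₁, e₂, e₂] at key

end

section

variable {E : Type*} [NormedAddCommGroup E] [InnerProductSpace ℝ E]

/-- Splitting a fourfold symmetric sum over `α ⊕ α` by the number of entries on each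
side. -/
theorem Fintype.sum_four_sum_type_of_symm {α : Type*} [Fintype α]
    (F : α ⊕ α → α ⊕ α → α ⊕ α → α ⊕ α → ℝ)
    (h₁ : ∀ a b c d, F b a c d = F a b c d) (h₂ : ∀ a b c d, F a c b d = F a b c d)
    (h₃ : ∀ a b c d, F a b d c = F a b c d) :
    ∑ a, ∑ b, ∑ c, ∑ d, F a b c d =
      ∑ i, ∑ j, ∑ k, ∑ l, F (.inl i) (.inl j) (.inl k) (.inl l) +
      4 * ∑ i, ∑ j, ∑ k, ∑ l, F (.inl i) (.inl j) (.inl k) (.inr l) +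
      6 * ∑ i, ∑ j, ∑ k, ∑ l, F (.inl i) (.inl j) (.inr k) (.inr l) +
      4 * ∑ i, ∑ j, ∑ k, ∑ l, F (.inl i) (.inr j) (.inr k) (.inr l) +
      ∑ i, ∑ j, ∑ k, ∑ l, F (.inr i) (.inr j) (.inr k) (.inr l) := by
  have s₁ : ∀ p q r s : α → α ⊕ α, ∑ i, ∑ j, ∑ k, ∑ l, F (q i) (p j) (r k) (s l) =
      ∑ i, ∑ j, ∑ k, ∑ l, F (p i) (q j) (r k) (s l) := fun p q r s => by
    rw [Finset.sum_comm]
    simp only [h₁ (p _) (q _)]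
  have s₂ : ∀ p q r s : α → α ⊕ α, ∑ i, ∑ j, ∑ k, ∑ l, F (p i) (r j) (q k) (s l) =
      ∑ i, ∑ j, ∑ k, ∑ l, F (p i) (q j) (r k) (s l) := fun p q r s =>
    Finset.sum_congr rfl fun i _ => by
      rw [Finset.sum_comm]
      simp only [h₂ _ (q _) (r _)]
  have s₃ : ∀ p q r s : α → α ⊕ α, ∑ i, ∑ j, ∑ k, ∑ l, F (p i) (q j) (s k) (r l) =
      ∑ i, ∑ j, ∑ k, ∑ l, F (p i) (q j) (r k) (s l) := fun p q r s =>
    Finset.sum_congr rfl fun i _ => Finset.sum_congr rfl fun j _ => by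
      rw [Finset.sum_comm]
      simp only [h₃ _ _ (r _) (s _)]
  simp only [Fintype.sum_sum_type, Finset.sum_add_distrib]
  simp only [s₁ Sum.inl Sum.inr, s₂ _ Sum.inl Sum.inr, s₃ _ _ Sum.inl Sum.inr]
  ring

theorem AlternatingMap.sq_le_of_forall_le {n : ℕ} (ω : E [⋀^Fin (n + 1)]→ₗ[ℝ] ℝ) {C : ℝ}
    (hC : ∀ u : Fin (n + 1) → E, (∀ i, ‖u i‖ = 1) → ω u ≤ C) {u : Fin (n + 1) → E}
    (hu : ∀ i, ‖u i‖ = 1) : ω u ^ 2 ≤ C ^ 2 := by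
  have h := hC (Function.update u 0 (-u 0)) fun j => by
    rcases eq_or_ne j 0 with rfl | hj
    · simpa using hu 0
    · simpa [hj] using hu j
  rw [ω.map_update_neg, Function.update_eq_self] at h
  exact sq_le_sq' (by linarith) (hC u hu)

/-- The components of a 4-form along four unit vectors. -/
theorem AlternatingMap.sum_sq_comp_le (ω : E [⋀^Fin 4]→ₗ[ℝ] ℝ) {C : ℝ}
    (hC : ∀ u : Fin 4 → E, (∀ i, ‖u i‖ = 1) → ω u ≤ C) {u : Fin 4 → E} (hu : ∀ i, ‖u i‖ = 1) :
    ∑ f : Fin 4 → Fin 4, ω (u ∘ f) ^ 2 ≤ 24 * C ^ 2 := by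
  classical
  calc ∑ f : Fin 4 → Fin 4, ω (u ∘ f) ^ 2
      ≤ ∑ f : Fin 4 → Fin 4, if Function.Injective f then C ^ 2 else 0 := by
        refine Finset.sum_le_sum fun f _ => ?_
        split_ifs with hf
        · exact ω.sq_le_of_forall_le hC fun i => hu _
        · rw [ω.map_eq_zero_of_not_injective _ fun h => hf h.of_comp]
          simp
    _ = 24 * C ^ 2 := by
        rw [← Finset.sum_filter, Finset.sum_const, nsmul_eq_mul]
        have h : Fintype.card (Fin 4 ↪ Fin 4) = 24 := by
          rw [Fintype.card_embedding_eq]; rfl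
        rw [← Fintype.card_congr (Equiv.subtypeInjectiveEquivEmbedding (Fin 4) (Fin 4)),
          Fintype.card_subtype] at h
        rw [h, Nat.cast_ofNat]

/-- At a maximum over unit vectors, the components with exactly one entry orthogonal to the
maximizing tuple vanish. -/
theorem AlternatingMap.map_three_of_max_eq_zero [FiniteDimensional ℝ E]
    (ω : E [⋀^Fin 4]→ₗ[ℝ] ℝ) {v : Fin 4 → E} (hv : ∀ i, ‖v i‖ = 1)
    (hmax : ∀ u : Fin 4 → E, (∀ i, ‖u i‖ = 1) → ω u ≤ ω v) {x : E} (hx : ∀ i, ⟪v i, x⟫ = 0)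
    (i j k : Fin 4) : ω ![v i, v j, v k, x] = 0 := by
  have hdec : ∀ i j k : Fin 4, i = j ∨ i = k ∨ j = k ∨ ∃ m, Function.Injective ![i, j, k, m] := by
    decide
  rcases hdec i j k with rfl | rfl | rfl | ⟨m, hm⟩
  · exact ω.map_eq_zero_of_eq _ (i := 0) (j := 1) rfl (by decide)
  · exact ω.map_eq_zero_of_eq _ (i := 0) (j := 2) rfl (by decide)
  · exact ω.map_eq_zero_of_eq _ (i := 1) (j := 2) rfl (by decide)
  · have h := ω.map_perm (Function.update v m x)
      (Equiv.ofBijective _ (Finite.injective_iff_bijective.1 hm))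
    rw [ω.update_eq_mul_inner hv hmax, hx, mul_zero, smul_zero] at h
    rw [← h]
    congr 1
    have h0 : i ≠ m := fun h => absurd (hm (a₁ := 0) (a₂ := 3) h) (by decide)
    have h1 : j ≠ m := fun h => absurd (hm (a₁ := 1) (a₂ := 3) h) (by decide)
    have h2 : k ≠ m := fun h => absurd (hm (a₁ := 2) (a₂ := 3) h) (by decide)
    ext t
    fin_cases t <;> simp [h0, h1, h2]

/-- In an orthonormal basis extending a maximizing tuple, the components of a 4-form satisfy the
Wirtinger bound. -/
theorem AlternatingMap.sum_sq_le_of_max [FiniteDimensional ℝ E] (ω : E [⋀^Fin 4]→ₗ[ℝ] ℝ)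
    {v : Fin 4 → E} (hmax : ∀ u : Fin 4 → E, (∀ i, ‖u i‖ = 1) → ω u ≤ ω v)
    {b : Fin 4 ⊕ Fin 4 → E} (hb : Orthonormal ℝ b) (hbv : ∀ i, b (.inl i) = v i) :
    ∑ f : Fin 4 → Fin 4 ⊕ Fin 4, ω (b ∘ f) ^ 2 ≤ 336 * ω v ^ 2 := by
  have hv : ∀ i, ‖v i‖ = 1 := fun i => by rw [← hbv]; exact hb.1 _
  set f : Fin 4 → E := fun k => b (.inr k) with hf
  have hfo : Orthonormal ℝ f := hb.comp _ Sum.inr_injective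
  have hvf : ∀ i k, ⟪v i, f k⟫ = 0 := fun i k => by
    rw [← hbv]; exact hb.2 (by simp)
  simp only [Fin.sum_univ_pi_succ, Fin.sum_univ_pi_zero, Function.comp_vecCons,
    Matrix.comp_vecEmpty]
  rw [Fintype.sum_four_sum_type_of_symm (fun p q r s => ω ![b p, b q, b r, b s] ^ 2)
    (fun p q r s => by simp only [ω.map_vecFour_swap_zero_one (b p) (b q), neg_sq])
    (fun p q r s => by simp only [ω.map_vecFour_swap_one_two _ (b q) (b r), neg_sq])
    (fun p q r s => by simp only [ω.map_vecFour_swap_two_three _ _ (b r) (b s), neg_sq])]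
  have h31 : ∀ i j k l, ω ![v i, v j, v k, b (.inr l)] = 0 := fun i j k l =>
    ω.map_three_of_max_eq_zero hv hmax (hvf · l) i j k
  simp only [hbv, h31]
  have h4 := ω.sum_sq_comp_le hmax hv
  have h0 := ω.sum_sq_comp_le hmax hfo.1
  simp only [Fin.sum_univ_pi_succ, Fin.sum_univ_pi_zero, Function.comp_vecCons,
    Matrix.comp_vecEmpty] at h4 h0
  set S : Fin 4 → Fin 4 → ℝ := fun i j => ∑ k, ∑ l, ω ![v i, v j, f k, f l] ^ 2 with hS
  set T : Fin 4 → ℝ := fun i => ∑ k, ∑ l, ∑ m, ω ![v i, f k, f l, f m] ^ 2 with hT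
  have hT0 : ∀ i, 0 ≤ T i := fun i => by positivity
  have hS0 : ∀ i, S i i = 0 := fun i => by
    have : ∀ k l, ω ![v i, v i, f k, f l] = 0 := fun k l =>
      ω.map_eq_zero_of_eq _ (i := 0) (j := 1) rfl (by decide)
    simp [hS, this]
  have hST : ∀ i j, i ≠ j → 6 * S i j + T i + T j ≤ 24 * ω v ^ 2 := fun i j hij =>
    ω.six_mul_sum_add_sum_le hmax (hv i) (hv j) hfo (hvf i) (hvf j)
  have h22 : 6 * ∑ i, ∑ j, S i j + 4 * ∑ i, T i ≤ 288 * ω v ^ 2 := by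
    clear_value S T
    simp only [Fin.sum_univ_four, hS0]
    linarith [hT0 0, hT0 1, hT0 2, hT0 3, hST 0 1 (by decide), hST 0 2 (by decide),
      hST 0 3 (by decide), hST 1 0 (by decide), hST 1 2 (by decide), hST 1 3 (by decide),
      hST 2 0 (by decide), hST 2 1 (by decide), hST 2 3 (by decide), hST 3 0 (by decide),
      hST 3 1 (by decide), hST 3 2 (by decide)]
  simp only [hS, hT] at h22
  simp only [ne_eq, OfNat.ofNat_ne_zero, not_false_eq_true, zero_pow, Finset.sum_const_zero]
  linarith

end

/-- The sum of the squares of all components counts each increasing multi-index `4! = 24` times. -/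
theorem twentyFour_mul_eNormSq_le (ω : Form4) :
    24 * eNormSq ω ≤ ∑ f : Fin 4 → Fin 8, ω (EuclideanSpace.basisFun (Fin 8) ℝ ∘ f) ^ 2 := by
  classical
  have hstd : ∀ f : Fin 4 → Fin 8,
      (fun i => stdB (f i)) = EuclideanSpace.basisFun (Fin 8) ℝ ∘ f := fun f => by
    ext1 i; simp [stdB]
  set s := Finset.univ.filter (fun f : Fin 4 → Fin 8 => StrictMono f) with hs
  clear_value s
  have hinj : Set.InjOn (fun p : (Fin 4 → Fin 8) × Equiv.Perm (Fin 4) => p.1 ∘ p.2)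
      {p | StrictMono p.1} := by
    rintro ⟨f, σ⟩ (hf : StrictMono f) ⟨g, τ⟩ (hg : StrictMono g) h
    have hfg : f = g := (hf.range_inj hg).1 (by simpa using congrArg Set.range h)
    subst hfg
    refine Prod.ext rfl (Equiv.ext fun i => hf.injective (congrFun h i))
  calc 24 * eNormSq ω
      = ∑ p ∈ s ×ˢ (Finset.univ : Finset (Equiv.Perm (Fin 4))),
          ω (EuclideanSpace.basisFun (Fin 8) ℝ ∘ (p.1 ∘ p.2)) ^ 2 := by
        rw [Finset.sum_product, eNormSq, Finset.mul_sum]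
        refine Finset.sum_congr (by simp [hs]) fun f _ => ?_
        have hp : ∀ σ : Equiv.Perm (Fin 4),
            ω (EuclideanSpace.basisFun (Fin 8) ℝ ∘ (f ∘ σ)) ^ 2 =
              ω (EuclideanSpace.basisFun (Fin 8) ℝ ∘ f) ^ 2 := fun σ => by
          rw [← Function.comp_assoc, ω.map_perm]
          rcases Int.units_eq_one_or (Equiv.Perm.sign σ) with h | h <;> simp [h]
        simp only [hp, hstd, Finset.sum_const, Finset.card_univ, Fintype.card_perm]
        simp [Nat.factorial]
    _ = ∑ f ∈ (s ×ˢ (Finset.univ : Finset (Equiv.Perm (Fin 4)))).image fun p => p.1 ∘ p.2,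
          ω (EuclideanSpace.basisFun (Fin 8) ℝ ∘ f) ^ 2 := by
        rw [Finset.sum_image (hinj.mono fun p hp => by simpa [hs] using hp)]
    _ ≤ ∑ f : Fin 4 → Fin 8, ω (EuclideanSpace.basisFun (Fin 8) ℝ ∘ f) ^ 2 :=
        Finset.sum_le_univ_sum_of_nonneg fun _ => sq_nonneg _

/-- Every 4-form `ω` on `ℝ⁸` satisfies `|ω|² ≤ 14 ‖ω‖²`, i.e. `14` bounds the
Wirtinger ratio `|ω|²/‖ω‖²`. -/
theorem wirtinger_le_fourteen (ω : Form4) :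
    eNormSq ω ≤ 14 * comass ω ^ 2 := by
  obtain ⟨v, hv, hmax⟩ := ω.exists_orthonormal_forall_le (by simp)
  have hcomass : comass ω = ω v :=
    IsGreatest.csSup_eq ⟨⟨v, hv.1, rfl⟩, by rintro _ ⟨u, hu, rfl⟩; exact hmax u hu⟩
  obtain ⟨b, hb⟩ := Orthonormal.exists_orthonormalBasis_extension_of_card_eq
    (𝕜 := ℝ) (E := E8) (ι := Fin 4 ⊕ Fin 4) (by simp)
    (v := Sum.elim v 0) (s := Set.range Sum.inl) (by
      refine ⟨?_, ?_⟩
      · rintro ⟨_, i, rfl⟩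
        simpa using hv.1 i
      · rintro ⟨_, i, rfl⟩ ⟨_, j, rfl⟩ hij
        simpa using hv.2 (show i ≠ j by rintro rfl; exact hij rfl))
  have h₁ := twentyFour_mul_eNormSq_le ω
  have h₂ := ω.toMultilinearMap.sum_sq_orthonormalBasis_eq (EuclideanSpace.basisFun (Fin 8) ℝ) b
  have h₃ := ω.sum_sq_le_of_max hmax b.orthonormal fun i => hb (.inl i) ⟨i, rfl⟩
  simp only [AlternatingMap.coe_multilinearMap] at h₂
  rw [hcomass]
  linarith
end
end
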